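/- Let ρ = Σ_α λ_α ρ_α be a convex combination of density matrices on a finite-dimensional Hilbert space and fix a basis. Then S(diag(ρ)) − Σ_α λ_α S(diag(ρ_α)) ≤ S_q(ρ) − Σ_α λ_α S_q(ρ_α), i.e., the Holevo-type quantity for the diagonals is bounded by that for the quantum states. -/

import Mathlib

open scoped ComplexOrder

noncomputable def eta (x : ℝ) : ℝ := -(x * Real.log x)

noncomputable def shannon {I : Type} [Fintype I] (p : I → ℝ) : ℝ := ∑ i, eta (p i)

noncomputable def vonNeumann {d : ℕ} {ρ : Matrix (Fin d) (Fin d) ℂ}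
    (h : ρ.IsHermitian) : ℝ := ∑ i, eta (h.eigenvalues i)

open Filter Topology Matrix in
lemma aux_term0 (r s m : ℝ) (h : s = 0 → m * r = 0) :
    Tendsto (fun t : ℝ => m * (r * Real.log (s + t * r))) (𝓝[>] 0)
      (𝓝 (m * (r * Real.log s))) := by
  by_cases hs : s = 0
  · have := h hs
    simp only [← mul_assoc, this, zero_mul]
    exact tendsto_const_nhds
  · have : ContinuousAt (fun t : ℝ => m * (r * Real.log (s + t * r))) 0 := by
      have h2 : s + 0 * r ≠ 0 := by simpa using hs
      fun_prop (disch := assumption)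
    have h3 := this.tendsto
    simp only [zero_mul, add_zero] at h3
    exact h3.mono_left nhdsWithin_le_nhds

open Filter Topology in
lemma aux_termInf (r s : ℝ) :
    Tendsto (fun t : ℝ => (r * Real.log (s / t + r))) atTop
      (𝓝 (r * Real.log r)) := by
  by_cases hr : r = 0
  · subst hr; simp
  · have h1 : Tendsto (fun t : ℝ => s / t + r) atTop (𝓝 (0 + r)) :=
      (tendsto_const_nhds.div_atTop tendsto_id).add tendsto_const_nhds
    rw [zero_add] at h1
    exact (h1.log hr).const_mul r

lemma aux_split (r s T : ℝ) (hr : 0 ≤ r) (hs : 0 ≤ s) (hT : 0 < T) :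
    r * Real.log (s + T * r) = r * Real.log (s / T + r) + r * Real.log T := by
  rcases hr.eq_or_lt with h | h
  · subst h; simp
  · have h1 : 0 < s / T + r := by positivity
    rw [← mul_add, ← Real.log_mul h1.ne' hT.ne']
    congr 2
    field_simp

lemma aux_deriv (r s t : ℝ) (hr : 0 ≤ r) (hs : 0 ≤ s) (ht : 0 < t) :
    HasDerivAt (fun t : ℝ => r * Real.log (s + t * r)) (r * r / (s + t * r)) t := by
  rcases hr.eq_or_lt with h | h
  · subst h; simpa using hasDerivAt_const t (0 : ℝ)
  · have h1 : s + t * r ≠ 0 := by positivity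
    have h2 : HasDerivAt (fun t : ℝ => s + t * r) r t := by
      simpa using ((hasDerivAt_id t).mul_const r).const_add s
    have := (h2.log h1).const_mul r
    rwa [← mul_div_assoc] at this

open Filter Topology in
lemma aux_scalar {ι : Type} [Fintype ι] (m : ι → ι → ℝ) (r s p q : ι → ℝ)
    (hr : ∀ i, 0 ≤ r i) (hs : ∀ i, 0 ≤ s i)
    (hp : ∀ i, 0 ≤ p i) (hq : ∀ i, 0 ≤ q i)
    (hm : ∀ k, ∑ l, m l k = 1) (hrp : ∑ k, r k = ∑ i, p i)
    (hsupp : ∀ l k, s l = 0 → m l k * r k = 0) (hsupp' : ∀ i, q i = 0 → p i = 0)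
    (h : ∀ t : ℝ, 0 < t → ∑ i, p i * p i / (q i + t * p i) ≤
      ∑ l, ∑ k, m l k * (r k * r k / (s l + t * r k))) :
    (∑ l, ∑ k, m l k * (r k * Real.log (s l))) - ∑ i, p i * Real.log (q i) ≤
      (∑ k, r k * Real.log (r k)) - ∑ i, p i * Real.log (p i) := by
  set G : ℝ → ℝ := fun t => (∑ l, ∑ k, m l k * (r k * Real.log (s l + t * r k))) -
    ∑ i, p i * Real.log (q i + t * p i) with hG
  have hd : ∀ t : ℝ, 0 < t → HasDerivAt G
      ((∑ l, ∑ k, m l k * (r k * r k / (s l + t * r k))) -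
        ∑ i, p i * p i / (q i + t * p i)) t := by
    intro t ht
    refine HasDerivAt.sub ?_ ?_
    · refine HasDerivAt.fun_sum fun l _ => HasDerivAt.fun_sum fun k _ => ?_
      exact (aux_deriv (r k) (s l) t (hr k) (hs l) ht).const_mul _
    · exact HasDerivAt.fun_sum fun i _ => aux_deriv (p i) (q i) t (hp i) (hq i) ht
  have hmono : MonotoneOn G (Set.Ioi 0) := by
    refine monotoneOn_of_deriv_nonneg (convex_Ioi 0) ?_ ?_ ?_
    · exact fun t ht => (hd t ht).continuousAt.continuousWithinAt
    · rw [interior_Ioi]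
      exact fun t ht => (hd t ht).differentiableAt.differentiableWithinAt
    · rw [interior_Ioi]
      intro t ht
      rw [(hd t ht).deriv]
      linarith [h t ht]
  have h0 : Tendsto G (𝓝[>] 0) (𝓝 ((∑ l, ∑ k, m l k * (r k * Real.log (s l))) -
      ∑ i, p i * Real.log (q i))) := by
    refine Tendsto.sub ?_ ?_
    · exact tendsto_finsetSum _ fun l _ => tendsto_finsetSum _ fun k _ =>
        aux_term0 _ _ _ (hsupp l k)
    · refine tendsto_finsetSum _ fun i _ => ?_
      simpa using aux_term0 (p i) (q i) 1 (by simpa using hsupp' i)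
  have hinf : Tendsto G atTop (𝓝 ((∑ k, r k * Real.log (r k)) -
      ∑ i, p i * Real.log (p i))) := by
    have e : (fun t : ℝ => (∑ l, ∑ k, m l k * (r k * Real.log (s l / t + r k))) -
        ∑ i, p i * Real.log (q i / t + p i)) =ᶠ[atTop] G := by
      filter_upwards [eventually_gt_atTop 0] with t ht
      simp only [hG]
      have e1 : ∑ l, ∑ k, m l k * (r k * Real.log (s l + t * r k)) =
          (∑ l, ∑ k, m l k * (r k * Real.log (s l / t + r k))) + (∑ k, r k) * Real.log t := by
        have : (∑ k, r k) * Real.log t = ∑ l, ∑ k, m l k * (r k * Real.log t) := by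
          rw [Finset.sum_comm]
          simp only [← Finset.sum_mul, hm, one_mul]
        rw [this, ← Finset.sum_add_distrib]
        refine Finset.sum_congr rfl fun l _ => ?_
        rw [← Finset.sum_add_distrib]
        refine Finset.sum_congr rfl fun k _ => ?_
        rw [aux_split _ _ _ (hr k) (hs l) ht, mul_add]
      have e2 : ∑ i, p i * Real.log (q i + t * p i) =
          (∑ i, p i * Real.log (q i / t + p i)) + (∑ k, p k) * Real.log t := by
        rw [Finset.sum_mul, ← Finset.sum_add_distrib]
        exact Finset.sum_congr rfl fun i _ => aux_split _ _ _ (hp i) (hq i) ht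
      rw [e1, e2, hrp]; ring
    refine Tendsto.congr' e ?_
    refine Tendsto.sub ?_ ?_
    · have : ∑ k, r k * Real.log (r k) = ∑ l, ∑ k, m l k * (r k * Real.log (r k)) := by
        rw [Finset.sum_comm]
        simp only [← Finset.sum_mul, hm, one_mul]
      rw [this]
      exact tendsto_finsetSum _ fun l _ => tendsto_finsetSum _ fun k _ =>
        (aux_termInf _ _).const_mul _
    · exact tendsto_finsetSum _ fun i _ => aux_termInf _ _
  have h1 : ∀ t : ℝ, 0 < t → G t ≤ (∑ k, r k * Real.log (r k)) -
      ∑ i, p i * Real.log (p i) := by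
    intro t ht
    refine ge_of_tendsto hinf ?_
    filter_upwards [eventually_ge_atTop t] with T hT
    exact hmono ht (ht.trans_le hT) hT
  refine le_of_tendsto h0 ?_
  filter_upwards [self_mem_nhdsWithin] with t ht using h1 t ht

open Matrix in
/-- trace identity: sum of weights times squared entries. -/
lemma aux_trL {d : ℕ} (s : Fin d → ℝ) (M : Matrix (Fin d) (Fin d) ℂ) :
    ((∑ l, ∑ k, s l * Complex.normSq (M l k) : ℝ) : ℂ) =
      (diagonal (fun l => (s l : ℂ)) * (M * Mᴴ)).trace := by
  simp only [trace, diag_apply, diagonal_mul]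
  simp only [mul_apply, conjTranspose_apply]
  push_cast
  refine Finset.sum_congr rfl fun l _ => ?_
  rw [Finset.mul_sum]
  refine Finset.sum_congr rfl fun k _ => ?_
  rw [Complex.normSq_eq_conj_mul_self]
  simp [mul_comm]

open Matrix in
lemma aux_trR {d : ℕ} (s : Fin d → ℝ) (M N : Matrix (Fin d) (Fin d) ℂ) :
    (∑ l, ∑ k, (s k : ℂ) * (star (M l k) * N l k)) =
      (diagonal (fun l => (s l : ℂ)) * (Mᴴ * N)).trace := by
  simp only [trace, diag_apply, diagonal_mul]
  simp only [mul_apply, conjTranspose_apply]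
  rw [Finset.sum_comm]
  simp only [Finset.mul_sum]

lemma aux_cs (r s t : ℝ) (c y : ℂ) (hr : 0 ≤ r) (hs : 0 ≤ s) (ht : 0 < t) :
    2 * (r * (star c * y).re) - s * Complex.normSq y - t * (r * Complex.normSq y) ≤
      Complex.normSq c * (r * r / (s + t * r)) := by
  rcases hr.eq_or_lt with h | h
  · subst h
    have := mul_nonneg hs (Complex.normSq_nonneg y)
    simp; linarith
  · have h1 : 0 < s + t * r := by positivity
    rw [← mul_div_assoc, le_div_iff₀ h1]
    simp only [Complex.normSq_apply, Complex.star_def, Complex.mul_re, Complex.conj_re,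
      Complex.conj_im]
    nlinarith [sq_nonneg (r * c.re - (s + t * r) * y.re), sq_nonneg (r * c.im - (s + t * r) * y.im)]

open Matrix in
lemma aux_matrix {d : ℕ} (U V P Q : Matrix (Fin d) (Fin d) ℂ) (r s : Fin d → ℝ)
    (hV : V * Vᴴ = 1) 
    (hP : P = U * diagonal (fun l => (r l : ℂ)) * Uᴴ)
    (hQ : Q = V * diagonal (fun l => (s l : ℂ)) * Vᴴ) (hU : U * Uᴴ = 1)
    (hr : ∀ i, 0 ≤ r i) (hs : ∀ i, 0 ≤ s i)
    (hp : ∀ i, 0 ≤ (P i i).re) (hq : ∀ i, 0 ≤ (Q i i).re) (t : ℝ) (ht : 0 < t) :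
    ∑ i, (P i i).re * (P i i).re / ((Q i i).re + t * (P i i).re) ≤
      ∑ l, ∑ k, Complex.normSq ((Vᴴ * U) l k) * (r k * r k / (s l + t * r k)) := by
  set y : Fin d → ℝ := fun i => (P i i).re / ((Q i i).re + t * (P i i).re) with hy
  set Y : Matrix (Fin d) (Fin d) ℂ := diagonal (fun i => (y i : ℂ)) with hY
  have hYH : Yᴴ = Y := by
    rw [hY, diagonal_conjTranspose]; congr 1; ext i; simp
  have hYY : Y * Y = diagonal (fun i => ((y i * y i : ℝ) : ℂ)) := by
    rw [hY, diagonal_mul_diagonal]; simp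
  have htr : ∀ (M : Matrix (Fin d) (Fin d) ℂ) (z : Fin d → ℝ),
      (M * diagonal (fun i => (z i : ℂ))).trace.re = ∑ i, (M i i).re * z i := by
    intro M z
    simp [trace, mul_diagonal]
  set C := Vᴴ * U with hC
  set D := Vᴴ * Y * U with hD
  have e1 : ∑ l, ∑ k, r k * (star (C l k) * D l k).re = ∑ i, (P i i).re * y i := by
    rw [← htr, ← hY]
    have := aux_trR r C D
    have h2 : (diagonal (fun l => (r l : ℂ)) * (Cᴴ * D)).trace = (P * Y).trace := by
      rw [hC, hD, hP, conjTranspose_mul, conjTranspose_conjTranspose]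
      have : Uᴴ * V * (Vᴴ * Y * U) = Uᴴ * (V * Vᴴ) * Y * U := by simp only [Matrix.mul_assoc]
      rw [this, hV, Matrix.mul_one, ← Matrix.mul_assoc, trace_mul_comm]
      simp only [Matrix.mul_assoc]
    rw [← h2, ← this]
    simp
  have e2 : ∑ l, ∑ k, s l * Complex.normSq (D l k) = ∑ i, (Q i i).re * (y i * y i) := by
    rw [← htr, ← hYY]
    have := aux_trL s D
    have h2 : (diagonal (fun l => (s l : ℂ)) * (D * Dᴴ)).trace = (Q * (Y * Y)).trace := by
      rw [hD, hQ, conjTranspose_mul, conjTranspose_mul, conjTranspose_conjTranspose, hYH]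
      have : Vᴴ * Y * U * (Uᴴ * (Y * V)) = Vᴴ * Y * (U * Uᴴ) * Y * V := by
        simp only [Matrix.mul_assoc]
      rw [this, hU, Matrix.mul_one, ← Matrix.mul_assoc, trace_mul_comm]
      simp only [Matrix.mul_assoc]
    rw [← h2, ← this, Complex.ofReal_re]
  have e3 : ∑ l, ∑ k, r k * Complex.normSq (D l k) = ∑ i, (P i i).re * (y i * y i) := by
    rw [← htr, ← hYY]
    have := aux_trR r D D
    have h2 : (diagonal (fun l => (r l : ℂ)) * (Dᴴ * D)).trace = (P * (Y * Y)).trace := by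
      rw [hD, hP, conjTranspose_mul, conjTranspose_mul, conjTranspose_conjTranspose, hYH]
      have : Uᴴ * (Y * V) * (Vᴴ * Y * U) = Uᴴ * Y * (V * Vᴴ) * Y * U := by
        simp only [Matrix.mul_assoc]
      rw [this, hV, Matrix.mul_one, ← Matrix.mul_assoc, trace_mul_comm]
      simp only [Matrix.mul_assoc]
    rw [← h2, ← this]
    simp [Complex.normSq_apply]
  calc _ = 2 * (∑ i, (P i i).re * y i) - (∑ i, (Q i i).re * (y i * y i)) -
        t * (∑ i, (P i i).re * (y i * y i)) := by
        simp only [Finset.mul_sum, ← Finset.sum_sub_distrib]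
        refine Finset.sum_congr rfl fun i _ => ?_
        simp only [hy]
        rcases (hp i).eq_or_lt with h | h
        · simp [← h]
        · have := hq i
          have : (Q i i).re + t * (P i i).re ≠ 0 := by positivity
          field_simp
          ring
    _ ≤ _ := by
        rw [← e1, ← e2, ← e3]
        simp only [Finset.mul_sum, ← Finset.sum_sub_distrib]
        exact Finset.sum_le_sum fun l _ => Finset.sum_le_sum fun k _ =>
          aux_cs _ _ _ _ _ (hr k) (hs l) ht

open Matrix in
lemma aux_spec {d : ℕ} {M : Matrix (Fin d) (Fin d) ℂ} (h : M.IsHermitian) :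
    ∃ U : Matrix (Fin d) (Fin d) ℂ, U * Uᴴ = 1 ∧ Uᴴ * U = 1 ∧
      M = U * diagonal (fun l => (h.eigenvalues l : ℂ)) * Uᴴ := by
  refine ⟨h.eigenvectorUnitary, ?_, ?_, ?_⟩
  · exact Unitary.coe_mul_star_self h.eigenvectorUnitary
  · exact Unitary.coe_star_mul_self h.eigenvectorUnitary
  · have := h.spectral_theorem
    rw [Unitary.conjStarAlgAut_apply] at this
    exact this

open Matrix in
lemma aux_w {d : ℕ} (U V P : Matrix (Fin d) (Fin d) ℂ) (r : Fin d → ℝ)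
    (hP : P = U * diagonal (fun l => (r l : ℂ)) * Uᴴ) (l : Fin d) :
    ∑ k, Complex.normSq ((Vᴴ * U) l k) * r k = ((Vᴴ * P * V) l l).re := by
  have : Vᴴ * P * V = (Vᴴ * U) * diagonal (fun l => (r l : ℂ)) * (Vᴴ * U)ᴴ := by
    rw [hP, conjTranspose_mul, conjTranspose_conjTranspose]; simp only [Matrix.mul_assoc]
  rw [this, mul_apply, Complex.re_sum]
  refine Finset.sum_congr rfl fun k _ => ?_
  rw [mul_diagonal, conjTranspose_apply]
  simp [Complex.normSq_apply]
  ring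

open Matrix in
theorem aux_main {d : ℕ} {A : Type} [Fintype A]
    (lam : A → ℝ) (ρa : A → Matrix (Fin d) (Fin d) ℂ)
    (hlam0 : ∀ a, 0 ≤ lam a)
    (hρa : ∀ a, (ρa a).PosSemidef)
    (ρ : Matrix (Fin d) (Fin d) ℂ) (hρdef : ρ = ∑ a, (lam a : ℂ) • ρa a)
    (hρ : ρ.IsHermitian) :
    shannon (fun i => (ρ i i).re) -
        ∑ a, lam a * shannon (fun i => (ρa a i i).re) ≤
      vonNeumann hρ - ∑ a, lam a * vonNeumann (hρa a).1 := by
  have hpsd : ρ.PosSemidef := by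
    rw [hρdef]
    exact posSemidef_sum _ fun a _ => (hρa a).smul (by exact_mod_cast hlam0 a)
  obtain ⟨V, hV, hV', hQ⟩ := aux_spec hρ
  set s := hρ.eigenvalues with hsdef
  have hs : ∀ l, 0 ≤ s l := fun l => hpsd.eigenvalues_nonneg l
  have hdiag : ∀ {M : Matrix (Fin d) (Fin d) ℂ}, M.PosSemidef → ∀ i, 0 ≤ (M i i).re := by
    intro M hM i
    exact (Complex.le_def.1 (hM.diag_nonneg (i := i))).1
  have hq_eq : ∀ i, (ρ i i).re = ∑ a, lam a * (ρa a i i).re := by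
    intro i
    rw [hρdef, Matrix.sum_apply, Complex.re_sum]
    simp
  set w : A → Fin d → ℝ := fun a l => ((Vᴴ * ρa a * V) l l).re with hw
  have hw0 : ∀ a l, 0 ≤ w a l := fun a l => hdiag ((hρa a).conjTranspose_mul_mul_same V) l
  have hs_eq : ∀ l, s l = ∑ a, lam a * w a l := by
    intro l
    have h1 : ((Vᴴ * ρ * V) l l).re = s l := by
      have : Vᴴ * ρ * V = diagonal (fun l => (s l : ℂ)) := by
        rw [hQ]
        calc _ = (Vᴴ * V) * diagonal (fun l => (s l : ℂ)) * (Vᴴ * V) := by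
              simp only [Matrix.mul_assoc]
          _ = _ := by rw [hV']; simp
      rw [this]; simp
    rw [← h1, hρdef, Matrix.mul_sum, Matrix.sum_mul, Matrix.sum_apply, Complex.re_sum]
    simp [hw]
  have key : ∀ a, lam a * ((∑ l, w a l * Real.log (s l)) -
      ∑ i, (ρa a i i).re * Real.log ((ρ i i).re)) ≤
      lam a * (shannon (fun i => (ρa a i i).re) - vonNeumann (hρa a).1) := by
    intro a
    rcases (hlam0 a).eq_or_lt with h | hpos
    · simp [← h]
    refine mul_le_mul_of_nonneg_left ?_ (hlam0 a)
    obtain ⟨U, hU, hU', hP⟩ := aux_spec (hρa a).1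
    set r := (hρa a).1.eigenvalues with hrdef
    have hr : ∀ l, 0 ≤ r l := fun l => (hρa a).eigenvalues_nonneg l
    have hww : ∀ l, ∑ k, Complex.normSq ((Vᴴ * U) l k) * r k = w a l :=
      fun l => aux_w U V _ r hP l
    have := aux_scalar (fun l k => Complex.normSq ((Vᴴ * U) l k)) r s
      (fun i => (ρa a i i).re) (fun i => (ρ i i).re) hr hs (hdiag (hρa a)) (hdiag hpsd)
      ?_ ?_ ?_ ?_ ?_
    · simp only [← mul_assoc, ← Finset.sum_mul, hww] at this
      simp only [shannon, vonNeumann, eta, Finset.sum_neg_distrib]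
      linarith
    · intro k
      have h1 : (((Vᴴ * U)ᴴ * (Vᴴ * U)) k k) = 1 := by
        have : (Vᴴ * U)ᴴ * (Vᴴ * U) = 1 := by
          rw [conjTranspose_mul, conjTranspose_conjTranspose]
          calc _ = Uᴴ * (V * Vᴴ) * U := by simp only [Matrix.mul_assoc]
            _ = 1 := by rw [hV, Matrix.mul_one, hU']
        rw [this]; simp
      rw [mul_apply] at h1
      have h2 := congrArg Complex.re h1
      rw [Complex.re_sum] at h2
      simpa [Complex.normSq_apply] using h2
    · have h1 : (ρa a).trace = ∑ k, (r k : ℂ) := (hρa a).1.trace_eq_sum_eigenvalues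
      have h2 := congrArg Complex.re h1
      simpa [trace] using h2.symm
    · intro l k hl
      have h1 : lam a * w a l = 0 := by
        rw [hs_eq] at hl
        exact (Finset.sum_eq_zero_iff_of_nonneg
          (fun b _ => mul_nonneg (hlam0 b) (hw0 b l))).1 hl a (Finset.mem_univ a)
      have h2 : w a l = 0 := (mul_eq_zero.1 h1).resolve_left hpos.ne'
      rw [← hww] at h2
      exact (Finset.sum_eq_zero_iff_of_nonneg
          (fun b _ => mul_nonneg (Complex.normSq_nonneg _) (hr b))).1 h2 k (Finset.mem_univ k)
    · intro i hi
      simp only [hq_eq] at hi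
      have h1 := (Finset.sum_eq_zero_iff_of_nonneg
          (fun b _ => mul_nonneg (hlam0 b) (hdiag (hρa b) i))).1 hi a (Finset.mem_univ a)
      exact (mul_eq_zero.1 h1).resolve_left hpos.ne'
    · exact fun t ht => aux_matrix U V _ _ r s hV hP hQ hU hr hs (hdiag (hρa a)) (hdiag hpsd) t ht
  have hsum := Finset.sum_le_sum fun a (_ : a ∈ Finset.univ) => key a
  simp only [mul_sub, Finset.sum_sub_distrib] at hsum
  have e1 : ∑ a, lam a * ∑ l, w a l * Real.log (s l) = - vonNeumann hρ := by
    simp only [vonNeumann, eta, Finset.sum_neg_distrib, neg_neg, Finset.mul_sum]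
    rw [Finset.sum_comm]
    refine Finset.sum_congr rfl fun l _ => ?_
    rw [← hsdef]
    conv_rhs => rw [hs_eq l, Finset.sum_mul]
    rw [← hs_eq l]
    exact Finset.sum_congr rfl fun a _ => by ring
  have e2 : ∑ a, lam a * ∑ i, (ρa a i i).re * Real.log ((ρ i i).re) =
      - shannon (fun i => (ρ i i).re) := by
    simp only [shannon, eta, Finset.sum_neg_distrib, neg_neg, Finset.mul_sum]
    rw [Finset.sum_comm]
    refine Finset.sum_congr rfl fun l _ => ?_
    have : (ρ l l).re * Real.log (ρ l l).re =
      (∑ a, lam a * (ρa a l l).re) * Real.log (ρ l l).re := by rw [← hq_eq]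
    rw [this, Finset.sum_mul]
    exact Finset.sum_congr rfl fun a _ => by ring
  rw [e1, e2] at hsum
  linarith


/-- the Holevo-type quantity for the diagonals is bounded by the
Holevo quantity for the quantum states. -/
theorem stmt7 {d : ℕ} {A : Type} [Fintype A]
    (lam : A → ℝ) (ρa : A → Matrix (Fin d) (Fin d) ℂ)
    (hlam0 : ∀ a, 0 ≤ lam a) (hlam1 : ∑ a, lam a = 1)
    (hρa : ∀ a, (ρa a).PosSemidef) (hρatr : ∀ a, (ρa a).trace = 1)
    (ρ : Matrix (Fin d) (Fin d) ℂ) (hρdef : ρ = ∑ a, (lam a : ℂ) • ρa a)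
    (hρ : ρ.IsHermitian) :
    shannon (fun i => (ρ i i).re) -
        ∑ a, lam a * shannon (fun i => (ρa a i i).re) ≤
      vonNeumann hρ - ∑ a, lam a * vonNeumann (hρa a).1 := by
  exact aux_main lam ρa hlam0 hρa ρ hρdef hρ
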